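/- For every positive integer r and every integer n ≥ 2, in ℤ[q] one has ∑_{σ ∈ G_{r,n}} q^{exc^Clr(σ)} (−1)^{cyc(σ)} = (q^r − 1) · ∑_{σ ∈ G_{r,n−1}} q^{exc^Clr(σ)} (−1)^{cyc(σ)}. -/

import Mathlib

open Finset Polynomial

/-- Number of excedances of a permutation: #{i : τ(i) > i}. -/
def exc {n : ℕ} (τ : Equiv.Perm (Fin n)) : ℕ :=
  (Finset.univ.filter fun i => i < τ i).card

/-- Number of cycles of a permutation, counting fixed points as cycles. -/
def cyc {n : ℕ} (τ : Equiv.Perm (Fin n)) : ℕ :=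
  Multiset.card τ.cycleType + (Finset.univ.filter fun i => τ i = i).card

/-- Color sum of a colored permutation. -/
def csum {r n : ℕ} (z : Fin n → Fin r) : ℕ := ∑ i, (z i : ℕ)

/-- #{i : z_i = 0 and τ(i) > i}. -/
def excA {r n : ℕ} (z : Fin n → Fin r) (τ : Equiv.Perm (Fin n)) : ℕ :=
  (Finset.univ.filter fun i => (z i : ℕ) = 0 ∧ i < τ i).card

/-- Excedance number with respect to the absolute order. -/
def excAbs {r n : ℕ} (z : Fin n → Fin r) (τ : Equiv.Perm (Fin n)) : ℕ :=
  exc τ + csum z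

/-- Excedance number with respect to the color order. -/
def excClr {r n : ℕ} (z : Fin n → Fin r) (τ : Equiv.Perm (Fin n)) : ℕ :=
  r * excA z τ + csum z

/-- The sign of a permutation of `Fin n` in terms of its number of cycles. -/
lemma neg_one_pow_cyc {n : ℕ} (τ : Equiv.Perm (Fin n)) :
    (-1 : Polynomial ℤ) ^ cyc τ = (-1) ^ n * ((Equiv.Perm.sign τ : ℤ) : Polynomial ℤ) := by
  have hcard : τ.support.card + (Finset.univ.filter fun i => τ i = i).card = n := by
    have h := Finset.card_filter_add_card_filter_not (s := (Finset.univ : Finset (Fin n)))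
      (fun i => τ i = i)
    have hs : τ.support = Finset.univ.filter fun i => ¬ τ i = i := by
      ext i
      simp
    rw [hs]
    simpa [add_comm] using h
  rw [Equiv.Perm.sign_of_cycleType, Equiv.Perm.sum_cycleType]
  push_cast
  rw [← pow_add, cyc]
  apply neg_one_pow_congr
  grind

/-- The generating polynomial of the colors of one letter, which is an excedance iff `p`. -/
noncomputable def letterWeight (r : ℕ) (p : Prop) [Decidable p] : Polynomial ℤ :=
  ∑ c : Fin r, X ^ (r * (if (c : ℕ) = 0 ∧ p then 1 else 0) + (c : ℕ))

lemma letterWeight_true_sub_false {r : ℕ} (hr : 0 < r) :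
    letterWeight r True - letterWeight r False = X ^ r - 1 := by
  obtain ⟨k, rfl⟩ := Nat.exists_eq_add_of_lt hr
  simp [letterWeight, Fin.sum_univ_succ]

lemma sum_X_pow_excClr (r : ℕ) {n : ℕ} (τ : Equiv.Perm (Fin n)) :
    ∑ z : Fin n → Fin r, (X : Polynomial ℤ) ^ excClr z τ =
      ∏ i, letterWeight r (i < τ i) := by
  simp only [letterWeight, Finset.prod_univ_sum, Fintype.piFinset_univ, Finset.prod_pow_eq_pow_sum,
    excClr, excA, csum, Finset.sum_add_distrib, ← Finset.mul_sum, Finset.card_filter]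

/-- The matrix with entries `a` strictly above the diagonal and `b` elsewhere. -/
def stepMatrix {R : Type*} (a b : R) (n : ℕ) : Matrix (Fin n) (Fin n) R :=
  Matrix.of fun i j => if i < j then a else b

lemma det_stepMatrix_succ_succ {R : Type*} [CommRing R] (a b : R) (m : ℕ) :
    (stepMatrix a b (m + 2)).det = (b - a) * (stepMatrix a b (m + 1)).det := by
  rw [← Matrix.det_updateRow_add_smul_self (stepMatrix a b (m + 2)) (i := 0) (j := 1)
    (by simp) (-1), Matrix.det_succ_row_zero, Finset.sum_eq_single 1]
  · have hminor : (Matrix.updateRow (stepMatrix a b (m + 2)) 0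
        (stepMatrix a b (m + 2) 0 + (-1 : R) • stepMatrix a b (m + 2) 1)).submatrix Fin.succ
        (Fin.succAbove 1) = stepMatrix a b (m + 1) := by
      ext i j
      have hlt : i.succ < Fin.succAbove 1 j ↔ i < j := by
        refine Fin.cases ?_ (fun k => ?_) j
        · simp
        · rw [Fin.one_succAbove_succ, Fin.succ_lt_succ_iff]
      simp [stepMatrix, hlt]
    rw [hminor]
    simp [stepMatrix, sub_eq_add_neg]
  · intro j _ hj
    have hlt : 0 < j ↔ 1 < j := by
      simp only [Fin.lt_def, Fin.ext_iff, ne_eq, Fin.val_zero, Fin.val_one] at *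
      omega
    simp [stepMatrix, hlt]
  · simp

lemma sum_excClr_cyc_eq_det (r n : ℕ) :
    ∑ σ : (Fin n → Fin r) × Equiv.Perm (Fin n),
      (X : Polynomial ℤ) ^ excClr σ.1 σ.2 * (-1) ^ cyc σ.2 =
    (-1) ^ n * (stepMatrix (letterWeight r True) (letterWeight r False) n).det := by
  rw [Fintype.sum_prod_type_right, ← Matrix.det_transpose, Matrix.det_apply', Finset.mul_sum]
  refine Finset.sum_congr rfl fun τ _ => ?_
  dsimp only
  rw [← Finset.sum_mul, sum_X_pow_excClr, neg_one_pow_cyc, mul_comm, mul_assoc]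
  congr 2
  refine Finset.prod_congr rfl fun i _ => ?_
  by_cases h : i < τ i <;> simp [stepMatrix, h]

theorem stmt3 (r n : ℕ) (hr : 0 < r) (hn : 2 ≤ n) :
    ∑ σ : (Fin n → Fin r) × Equiv.Perm (Fin n),
      (X : Polynomial ℤ) ^ excClr σ.1 σ.2 * (-1) ^ cyc σ.2 =
    ((X : Polynomial ℤ) ^ r - 1) *
      ∑ σ : (Fin (n - 1) → Fin r) × Equiv.Perm (Fin (n - 1)),
        (X : Polynomial ℤ) ^ excClr σ.1 σ.2 * (-1) ^ cyc σ.2 := by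
  obtain ⟨m, rfl⟩ := Nat.exists_eq_add_of_le' hn
  rw [show m + 2 - 1 = m + 1 from rfl, sum_excClr_cyc_eq_det, sum_excClr_cyc_eq_det,
    det_stepMatrix_succ_succ, ← letterWeight_true_sub_false hr]
  ring
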